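/- If G is a finite group with the Magnus Property, then the index of every maximal subgroup of G belongs to {2, 3, 4, 5, 7, 9}. -/

import Mathlib

/-- A group has the Magnus Property if any two elements with the same normal
closure are conjugate or inverse-conjugate. -/
def MagnusProperty (G : Type*) [Group G] : Prop :=
  ∀ x y : G, Subgroup.normalClosure {x} = Subgroup.normalClosure {y} →
    IsConj x y ∨ IsConj x y⁻¹

/-- An action by additive endomorphisms in which only the identity has nonzero fixed points. -/
def IsSemiregularAction {H V : Type*} [Group H] [AddCommGroup V]
    (ρ : H →* AddMonoid.End V) : Prop :=
  ∀ (h : H) (v : V), ρ h v = v → h = 1 ∨ v = 0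

/-- Commuting elements of the same prime order generate the same cyclic subgroup. -/
def CommutingPrimeCyclic (H : Type*) [Group H] : Prop :=
  ∀ (q : ℕ) (b h : H), q.Prime → b ≠ 1 → b ^ q = 1 → h ^ q = 1 → Commute b h →
    h ∈ Subgroup.zpowers b

/-- Elements of prime order centralize every cyclic subgroup they normalize. -/
def PrimeOrderCentralizes (H : Type*) [Group H] : Prop :=
  ∀ (r : ℕ) (b h : H), r.Prime → h ^ r = 1 → h * b * h⁻¹ ∈ Subgroup.zpowers b → Commute h b

namespace IsSemiregularAction

variable {H V : Type*} [Group H] [AddCommGroup V] {ρ : H →* AddMonoid.End V}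

theorem sum_pow_eq_zero (hρ : IsSemiregularAction ρ) {c : H} (hc : c ≠ 1) {m : ℕ}
    (hm : c ^ m = 1) : ∑ i ∈ Finset.range m, ρ c ^ i = 0 := by
  have h1 : (ρ c - 1) * ∑ i ∈ Finset.range m, ρ c ^ i = 0 := by
    rw [mul_geom_sum, ← map_pow, hm, map_one, sub_self]
  ext v
  have h2 := DFunLike.congr_fun h1 v
  rw [sub_mul, one_mul] at h2
  have h3 : ρ c ((∑ i ∈ Finset.range m, ρ c ^ i) v) = (∑ i ∈ Finset.range m, ρ c ^ i) v :=
    sub_eq_zero.mp h2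
  exact (hρ c _ h3).resolve_left hc

theorem natCast_ne_zero [Nontrivial V] [Finite V] {m n : ℕ} (hn : n.Coprime (Nat.card V))
    (hm : m ∣ n) : (m : AddMonoid.End V) ≠ 0 := by
  intro h0
  obtain ⟨v, hv⟩ := exists_ne (0 : V)
  have h1 : m • v = 0 := by
    have := DFunLike.congr_fun h0 v
    simpa using this
  have h2 : addOrderOf v ∣ 1 := by
    rw [← Nat.Coprime.coprime_dvd_left hm hn]
    exact Nat.dvd_gcd (addOrderOf_dvd_of_nsmul_eq_zero h1) (addOrderOf_dvd_natCard v)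
  exact hv (AddMonoid.addOrderOf_eq_one_iff.mp (Nat.dvd_one.mp h2))

theorem commutingPrimeCyclic [Nontrivial V] [Finite V] [Finite H] (hρ : IsSemiregularAction ρ)
    (hco : (Nat.card H).Coprime (Nat.card V)) : CommutingPrimeCyclic H := by
  intro q b h hq hb hbq hhq hbh
  by_contra hnot
  have hq0 := hq.pos
  have hqo : orderOf b = q := orderOf_eq_prime hbq hb (hp := ⟨hq⟩)
  have hqd : q ∣ Nat.card H := hqo ▸ orderOf_dvd_natCard b
  apply natCast_ne_zero hco hqd
  have h1 : ∑ i ∈ Finset.range q, ∑ j ∈ Finset.range q, ρ (b ^ i * h) ^ j = 0 := by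
    refine Finset.sum_eq_zero fun i _ => hρ.sum_pow_eq_zero ?_ ?_
    · intro h2
      apply hnot
      rw [← inv_eq_of_mul_eq_one_right h2]
      exact inv_mem (Subgroup.npow_mem_zpowers b i)
    · rw [(hbh.pow_left i).mul_pow, hhq, ← pow_mul, mul_comm, pow_mul, hbq]; simp
  rw [Finset.sum_comm, Finset.sum_eq_single_of_mem 0 (Finset.mem_range.mpr hq0)] at h1
  · simpa using h1
  · intro j hj hj0
    rw [Finset.mem_range] at hj
    have hbj : b ^ j ≠ 1 := by
      intro h2
      have := orderOf_dvd_of_pow_eq_one h2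
      rw [hqo] at this
      exact absurd (Nat.le_of_dvd (Nat.pos_of_ne_zero hj0) this) (by omega)
    have h3 : ∀ i, ρ (b ^ i * h) ^ j = ρ (b ^ j) ^ i * ρ (h ^ j) := by
      intro i
      rw [← map_pow, ← map_pow, ← map_mul, (hbh.pow_left i).mul_pow, ← pow_mul, ← pow_mul,
        mul_comm i]
    simp_rw [h3]
    rw [← Finset.sum_mul, hρ.sum_pow_eq_zero hbj, zero_mul]
    rw [← pow_mul, mul_comm, pow_mul, hbq, one_pow]

theorem primeOrderCentralizes [Nontrivial V] [Finite V] [Finite H] (hρ : IsSemiregularAction ρ)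
    (hco : (Nat.card H).Coprime (Nat.card V)) : PrimeOrderCentralizes H := by
  intro r b h hr hhr hn
  by_contra hnot
  have hr0 := hr.pos
  have hh : h ≠ 1 := by rintro rfl; exact hnot (Commute.one_left b)
  have hho : orderOf h = r := orderOf_eq_prime hhr hh (hp := ⟨hr⟩)
  have hnj : ∀ j : ℕ, h ^ j * b * (h ^ j)⁻¹ ∈ Subgroup.zpowers b := by
    intro j
    induction j with
    | zero => simp
    | succ j ih =>
      obtain ⟨t, ht⟩ := Subgroup.mem_zpowers_iff.mp ih
      have : h ^ (j + 1) * b * (h ^ (j + 1))⁻¹ = (h * b * h⁻¹) ^ t := by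
        rw [conj_zpow, ht, pow_succ']; group
      rw [this]
      exact zpow_mem hn t
  apply natCast_ne_zero hco (orderOf_dvd_natCard b)
  have h1 : ∑ i ∈ Finset.range (orderOf b), ∑ j ∈ Finset.range r,
      ρ (b ^ i) * ρ h ^ j * ρ (b ^ i)⁻¹ = 0 := by
    refine Finset.sum_eq_zero fun i _ => ?_
    rw [← Finset.sum_mul, ← Finset.mul_sum, hρ.sum_pow_eq_zero hh hhr]; simp
  rw [Finset.sum_comm, Finset.sum_eq_single_of_mem 0 (Finset.mem_range.mpr hr0)] at h1
  · simpa only [pow_zero, mul_one, ← map_mul, mul_inv_cancel, map_one, Finset.sum_const,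
      Finset.card_range, nsmul_one] using h1
  · intro j hj hj0
    rw [Finset.mem_range] at hj
    set c := h ^ j * b⁻¹ * (h ^ j)⁻¹ with hc
    have hcmem : c ∈ Subgroup.zpowers b := by
      have : c = (h ^ j * b * (h ^ j)⁻¹)⁻¹ := by rw [hc]; group
      rw [this]
      exact inv_mem (hnj j)
    have hbc : Commute b c := by
      obtain ⟨t, ht⟩ := Subgroup.mem_zpowers_iff.mp hcmem
      rw [← ht]; exact (Commute.refl b).zpow_right t
    have hbc1 : b * c ≠ 1 := by
      intro h2
      apply hnot
      have h3 : Commute (h ^ j) b := by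
        have h4 : h ^ j * b * (h ^ j)⁻¹ = b := by
          have h5 : c⁻¹ = h ^ j * b * (h ^ j)⁻¹ := by rw [hc]; group
          rw [← h5, ← eq_inv_of_mul_eq_one_left h2]
        exact mul_inv_eq_iff_eq_mul.mp h4
      have h5 : h ∈ Subgroup.zpowers (h ^ j) := by
        rw [mem_zpowers_pow_iff, hho, Nat.gcd_comm]
        exact Nat.coprime_of_lt_prime hj0 hj hr
      obtain ⟨t, ht⟩ := Subgroup.mem_zpowers_iff.mp h5
      rw [← ht]; exact h3.zpow_left t
    have h3 : ∀ i, ρ (b ^ i) * ρ h ^ j * ρ (b ^ i)⁻¹ = ρ (b * c) ^ i * ρ (h ^ j) := by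
      intro i
      rw [← map_pow, ← map_pow, ← map_mul, ← map_mul, ← map_mul, hbc.mul_pow, hc, conj_pow]
      congr 1
      group
    simp_rw [h3]
    rw [← Finset.sum_mul, hρ.sum_pow_eq_zero hbc1, zero_mul]
    rw [hbc.mul_pow, pow_orderOf_eq_one, hc, conj_pow, inv_pow, pow_orderOf_eq_one]
    simp

theorem map_involution (hρ : IsSemiregularAction ρ) {z : H} (hz : z ≠ 1) (hz2 : z ^ 2 = 1) :
    ρ z = -1 := by
  have := hρ.sum_pow_eq_zero hz hz2
  rw [Finset.sum_range_succ, Finset.sum_range_one, pow_zero, pow_one] at this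
  exact eq_neg_of_add_eq_zero_right this

theorem injective [Nontrivial V] (hρ : IsSemiregularAction ρ) : Function.Injective ρ := by
  rw [injective_iff_map_eq_one]
  intro h hh
  obtain ⟨v, hv⟩ := exists_ne (0 : V)
  exact (hρ h v (by rw [hh]; rfl)).resolve_right hv

theorem involution_unique [Nontrivial V] (hρ : IsSemiregularAction ρ) {y z : H} (hz : z ≠ 1)
    (hz2 : z ^ 2 = 1) (hy2 : y ^ 2 = 1) : y = 1 ∨ y = z := by
  by_cases hy : y = 1
  · exact Or.inl hy
  · right
    apply hρ.injective
    rw [hρ.map_involution hz hz2, hρ.map_involution hy hy2]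

end IsSemiregularAction

section ClassTwo

variable {H : Type*} [Group H]

theorem pow_mul_eq_of_class_two {f x w : H} (h : f * x = x * f * w) (hwf : Commute w f) (m : ℕ) :
    f ^ m * x = x * f ^ m * w ^ m := by
  induction m with
  | zero => simp
  | succ m ih =>
    calc f ^ (m + 1) * x = f ^ m * x * (f * w) := by rw [pow_succ, mul_assoc, h]; group
      _ = x * f ^ m * (w ^ m * f) * w := by rw [ih]; group
      _ = x * f ^ (m + 1) * w ^ (m + 1) := by rw [(hwf.pow_left m).eq]; group

theorem mul_pow_of_class_two {f x w : H} (h : f * x = x * f * w) (hwf : Commute w f)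
    (hwx : Commute w x) (n : ℕ) : (x * f) ^ n = x ^ n * f ^ n * w ^ n.choose 2 := by
  induction n with
  | zero => simp
  | succ n ih =>
    have hc : n.succ.choose 2 = n + n.choose 2 := by
      rw [Nat.succ_eq_add_one, Nat.choose_succ_succ' n 1, Nat.choose_one_right]
    calc (x * f) ^ (n + 1) = x ^ n * f ^ n * (w ^ n.choose 2 * (x * f)) := by
          rw [pow_succ, ih]; group
      _ = x ^ n * (f ^ n * x) * f * w ^ n.choose 2 := by
          rw [((hwx.mul_right hwf).pow_left _).eq]; group
      _ = x ^ (n + 1) * f ^ n * (w ^ n * f) * w ^ n.choose 2 := by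
          rw [pow_mul_eq_of_class_two h hwf, pow_succ x]; group
      _ = x ^ (n + 1) * f ^ (n + 1) * w ^ (n + 1).choose 2 := by
          rw [(hwf.pow_left n).eq, hc, pow_add w, pow_succ f]; group

/-- Two elements of `r`-power order with central commutator of order dividing `r` commute, unless
they look like the generators of a quaternion group. -/
theorem CommutingPrimeCyclic.eq_one_of_class_two [Finite H] (hP : CommutingPrimeCyclic H) {r : ℕ}
    (hr : r.Prime) {k l : ℕ} {f x w : H} (hf : f ^ r ^ k = 1) (hx : x ^ r ^ l = 1)
    (h : f * x = x * f * w) (hwf : Commute w f) (hwx : Commute w x) (hwr : w ^ r = 1)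
    (h4 : r ≠ 2 ∨ x ^ 4 ≠ 1 ∨ f ^ 4 ≠ 1) : w = 1 := by
  induction hn : k + l using Nat.strong_induction_on generalizing k l f x w with
  | _ n ih =>
  by_contra hw
  wlog hlk : l ≤ k generalizing k l f x w
  · have h' : x * f = f * x * w⁻¹ := by rw [h]; group
    exact this hx hf h' hwx.inv_left hwf.inv_left (by rw [inv_pow, hwr, inv_one]) (by tauto)
      (by omega) (by simpa using hw) (by omega)
  obtain _ | l := l
  · rw [pow_zero, pow_one] at hx
    subst hx
    simp at h
    exact hw h
  obtain _ | k := k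
  · omega
  rw [pow_succ, pow_mul] at hx hf
  by_cases hX : x ^ r ^ l = 1
  · exact hw (ih (k + 1 + l) (by omega) (by rw [pow_succ, pow_mul, hf]) hX h hwf hwx hwr h4 rfl)
  by_cases hF : f ^ r ^ k = 1
  · exact hw (ih (k + (l + 1)) (by omega) hF (by rw [pow_succ, pow_mul, hx]) h hwf hwx hwr h4 rfl)
  have hXw := hP r w _ hr hw hwr hx (hwx.pow_right _)
  have hFw := hP r w _ hr hw hwr hf (hwf.pow_right _)
  have hFX : Commute (f ^ r ^ k) (x ^ r ^ l) := by
    obtain ⟨s, hs⟩ := Subgroup.mem_zpowers_iff.mp hXw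
    rw [← hs]
    exact ((hwf.symm.pow_left _).zpow_right s)
  have hXF := inv_mem (hP r _ _ hr hF hf hx hFX)
  rw [← mem_powers_iff_mem_zpowers] at hXF
  obtain ⟨i, hi⟩ := hXF
  simp only at hi
  have hf4 : r = 2 → 2 ≤ k := by
    rintro rfl
    by_contra hk
    have hx4 : x ^ 4 = 1 := by
      have : (2 : ℕ) ^ l * 2 ∣ 4 := by
        have : l = 0 ∨ l = 1 := by omega
        rcases this with rfl | rfl <;> norm_num
      rw [← pow_mul] at hx
      exact orderOf_dvd_iff_pow_eq_one.mp ((orderOf_dvd_of_pow_eq_one hx).trans this)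
    have hf4 : f ^ 4 = 1 := by
      have : (2 : ℕ) ^ k * 2 ∣ 4 := by
        have : k = 0 ∨ k = 1 := by omega
        rcases this with rfl | rfl <;> norm_num
      rw [← pow_mul] at hf
      exact orderOf_dvd_iff_pow_eq_one.mp ((orderOf_dvd_of_pow_eq_one hf).trans this)
    tauto
  set e := i * r ^ (k - l) with he
  have hdvd : r ∣ e * (r ^ l).choose 2 := by
    by_cases h2 : 2 = r ^ l
    · have hr2 : r ∣ 2 := by
        have hl : l ≠ 0 := by rintro rfl; simp at h2
        exact h2 ▸ dvd_pow_self r hl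
      have hr2 : r = 2 := (Nat.prime_dvd_prime_iff_eq hr Nat.prime_two).mp hr2
      have hl : l = 1 := by
        subst hr2
        exact (Nat.pow_right_injective le_rfl (by simpa using h2)).symm
      have := hf4 hr2
      exact ((dvd_pow_self r (by omega)).mul_left i).mul_right _
    · exact (hr.dvd_choose_pow two_ne_zero h2).mul_left e
  have hw0 : (w ^ e) ^ (r ^ l).choose 2 = 1 := by
    obtain ⟨t, ht⟩ := hdvd
    rw [← pow_mul, ht, pow_mul, hwr, one_pow]
  have hx' : (x * f ^ e) ^ r ^ l = 1 := by
    rw [mul_pow_of_class_two (pow_mul_eq_of_class_two h hwf e) ((hwf.pow_left e).pow_right e)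
      (hwx.pow_left e), hw0, mul_one, ← pow_mul f, he, mul_assoc, ← pow_add,
      Nat.sub_add_cancel (by omega), mul_comm, pow_mul, hi, mul_inv_cancel]
  refine hw (ih (k + 1 + l) (by omega) (f := f) (x := x * f ^ e) (by rw [pow_succ, pow_mul, hf])
    hx' ?_ hwf (hwx.mul_right (hwf.pow_right e)) hwr ?_ rfl)
  · rw [← mul_assoc, h, mul_assoc _ w, (hwf.pow_right e).eq]; group
  · by_cases hr2 : r = 2
    · right; right
      intro h4
      apply hF
      have : 4 ∣ r ^ k := by
        rw [hr2]; exact pow_dvd_pow 2 (hf4 hr2)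
      exact orderOf_dvd_iff_pow_eq_one.mp ((orderOf_dvd_of_pow_eq_one h4).trans this)
    · exact Or.inl hr2

end ClassTwo

/-- There is at most one involution. -/
def AtMostOneInvolution (H : Type*) [Group H] : Prop :=
  ∀ y z : H, z ≠ 1 → z ^ 2 = 1 → y ^ 2 = 1 → y = 1 ∨ y = z

theorem AtMostOneInvolution.commute {H : Type*} [Group H] (hI : AtMostOneInvolution H) {z : H}
    (hz2 : z ^ 2 = 1) (g : H) : Commute g z := by
  by_cases hz : z = 1
  · exact hz ▸ Commute.one_right g
  · rcases hI (g * z * g⁻¹) z hz hz2 (by rw [conj_pow, hz2]; group) with h | h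
    · exact absurd (conj_eq_one_iff.mp h) hz
    · exact mul_inv_eq_iff_eq_mul.mp h

theorem MagnusProperty.exists_conj {G : Type*} [Group G] (hG : MagnusProperty G) {x y : G}
    (h : Subgroup.normalClosure {x} = Subgroup.normalClosure {y}) :
    ∃ g, g * x * g⁻¹ = y ∨ g * x * g⁻¹ = y⁻¹ := by
  rcases hG x y h with h | h
  · obtain ⟨g, hg⟩ := isConj_iff.mp h
    exact ⟨g, Or.inl hg⟩
  · obtain ⟨g, hg⟩ := isConj_iff.mp h
    exact ⟨g, Or.inr hg⟩

theorem MagnusProperty.exists_conj_pow {G : Type*} [Group G] [Finite G] (hG : MagnusProperty G)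
    {x : G} {k : ℕ} (hk : (orderOf x).Coprime k) :
    ∃ g, g * x * g⁻¹ = x ^ (k : ℤ) ∨ g * x * g⁻¹ = x ^ (-k : ℤ) := by
  have h := hG.exists_conj (x := x) (y := x ^ k) ?_
  · simpa using h
  apply le_antisymm <;> apply Subgroup.normalClosure_le_normal <;>
    rw [Set.singleton_subset_iff]
  · have h1 : x ∈ Subgroup.zpowers (x ^ k) := by
      rw [mem_zpowers_pow_iff, Nat.gcd_comm]
      exact hk
    have h2 : Subgroup.zpowers (x ^ k) ≤ Subgroup.normalClosure {x ^ k} :=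
      Subgroup.zpowers_le.mpr (Subgroup.subset_normalClosure (Set.mem_singleton _))
    exact h2 h1
  · have h2 : x ∈ Subgroup.normalClosure {x} :=
      Subgroup.subset_normalClosure (Set.mem_singleton x)
    exact pow_mem h2 k

section Orders

variable {H : Type*} [Group H]

theorem conj_pow_eq_zpow_pow {g x : H} {t : ℤ} (h : g * x * g⁻¹ = x ^ t) (n : ℕ) :
    g ^ n * x * (g ^ n)⁻¹ = x ^ t ^ n := by
  induction n with
  | zero => simp
  | succ n ih =>
    calc g ^ (n + 1) * x * (g ^ (n + 1))⁻¹ = g ^ n * (g * x * g⁻¹) * (g ^ n)⁻¹ := by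
          rw [pow_succ]; group
      _ = x ^ t ^ (n + 1) := by rw [h, ← conj_zpow, ih, ← zpow_mul, pow_succ]

theorem exists_pow_prime_pow_eq_one [Finite H] (g : H) {r : ℕ} (hr : r.Prime) :
    ∃ M a : ℕ, ¬ r ∣ M ∧ (g ^ M) ^ r ^ a = 1 := by
  obtain ⟨a, M, hM, h⟩ := Nat.exists_eq_pow_mul_and_not_dvd (orderOf_pos g).ne' r hr.ne_one
  exact ⟨M, a, hM, by rw [← pow_mul, mul_comm, ← h, pow_orderOf_eq_one]⟩

theorem CommutingPrimeCyclic.zpow_sub_one_eq_one [Finite H] (hP : CommutingPrimeCyclic H) {r : ℕ}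
    (hr : r.Prime) {k l : ℕ} {f x : H} {T : ℤ} (hf : f ^ r ^ k = 1) (hx : x ^ r ^ l = 1)
    (h : f * x * f⁻¹ = x ^ T) (hT : (r : ℤ) ∣ T - 1) (hxT : x ^ ((T - 1) * r) = 1)
    (h4 : r ≠ 2 ∨ x ^ 4 ≠ 1 ∨ f ^ 4 ≠ 1) : x ^ (T - 1) = 1 := by
  have hc : Commute (x ^ (T - 1)) f := by
    have h1 : f * x ^ (T - 1) * f⁻¹ = x ^ (T - 1) := by
      rw [← conj_zpow, h, ← zpow_mul]
      obtain ⟨s, hs⟩ := hT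
      have : T * (T - 1) = (T - 1) + (T - 1) * r * s := by rw [mul_assoc, ← hs]; ring
      rw [this, zpow_add, zpow_mul x _ s, hxT, one_zpow, mul_one]
    exact (mul_inv_eq_iff_eq_mul.mp h1).symm
  refine hP.eq_one_of_class_two hr hf hx ?_ hc ((Commute.refl x).zpow_left _) ?_ h4
  · rw [mul_assoc, ← hc.eq, ← mul_assoc, ← zpow_one_add, add_sub_cancel, ← h]
    group
  · rw [← zpow_natCast, ← zpow_mul, hxT]

theorem MagnusProperty.orderOf_ne_sq [Finite H] (hH : MagnusProperty H)
    (hP : CommutingPrimeCyclic H) {r : ℕ} (hr : r.Prime) (hr2 : r ≠ 2) (x : H) :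
    orderOf x ≠ r ^ 2 := by
  intro hx
  have hcop : (orderOf x).Coprime (1 + r) := by
    rw [hx]
    apply Nat.Coprime.pow_left
    simp
  obtain ⟨g, hg⟩ := hH.exists_conj_pow hcop
  have hg2 : ∃ f : H, f * x * f⁻¹ = x ^ ((1 + r : ℤ) ^ 2) := by
    refine ⟨g ^ 2, ?_⟩
    rcases hg with hg | hg
    · rw [conj_pow_eq_zpow_pow hg]; push_cast; rfl
    · rw [conj_pow_eq_zpow_pow hg, neg_sq]; push_cast; rfl
  obtain ⟨f, hf⟩ := hg2
  obtain ⟨M, a, hM, hMa⟩ := exists_pow_prime_pow_eq_one f hr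
  have hf' := conj_pow_eq_zpow_pow hf M
  have hexp : ∀ n : ℕ, ∃ s : ℤ, (1 + r : ℤ) ^ n = 1 + n * r + r ^ 2 * s := by
    intro n
    induction n with
    | zero => exact ⟨0, by simp⟩
    | succ n ih =>
      obtain ⟨s, hs⟩ := ih
      refine ⟨n + s + r * s, ?_⟩
      rw [pow_succ, hs]; push_cast; ring
  obtain ⟨s, hs⟩ := hexp (2 * M)
  rw [← pow_mul, hs] at hf'
  have hxr : ∀ n : ℤ, x ^ n = 1 ↔ (r : ℤ) ^ 2 ∣ n := by
    intro n
    rw [← orderOf_dvd_iff_zpow_eq_one, hx]; push_cast; rfl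
  have key := hP.zpow_sub_one_eq_one hr hMa (l := 2) (by rw [← hx, pow_orderOf_eq_one]) hf'
    ⟨2 * M + r * s, by push_cast; ring⟩
    ((hxr _).mpr ⟨2 * M + r * s, by push_cast; ring⟩) (Or.inl hr2)
  rw [hxr] at key
  have h1 : (r : ℤ) ^ 2 ∣ r * ((2 * M : ℕ) : ℤ) := by
    have := dvd_sub key (Dvd.intro s rfl : (r : ℤ) ^ 2 ∣ r ^ 2 * s)
    have h3 : (1 + ((2 * M : ℕ) : ℤ) * r + r ^ 2 * s) - 1 - r ^ 2 * s = r * (2 * M : ℕ) := by ring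
    rwa [h3] at this
  have h2 : r ^ 2 ∣ r * (2 * M) := by exact_mod_cast h1
  rw [sq] at h2
  rcases hr.dvd_mul.mp (Nat.dvd_of_mul_dvd_mul_left hr.pos h2) with h | h
  · exact hr2 ((Nat.prime_dvd_prime_iff_eq hr Nat.prime_two).mp h)
  · exact hM h

theorem Odd.three_pow_mod_eight {M : ℕ} (hM : Odd M) : (8 : ℤ) ∣ 3 ^ M - 3 := by
  obtain ⟨k, rfl⟩ := hM
  have : (8 : ℤ) ∣ 9 ^ k - 1 := by
    simpa using (by norm_num : (8 : ℤ) ∣ 9 - 1).trans (sub_dvd_pow_sub_pow 9 1 k)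
  obtain ⟨s, hs⟩ := this
  refine ⟨3 * s, ?_⟩
  rw [pow_succ, pow_mul]
  norm_num
  linarith

theorem MagnusProperty.orderOf_ne_eight [Finite H] (hH : MagnusProperty H)
    (hP : CommutingPrimeCyclic H) (hI : AtMostOneInvolution H) (x : H) : orderOf x ≠ 8 := by
  intro hx
  obtain ⟨g, hg⟩ := hH.exists_conj_pow (x := x) (k := 3) (by rw [hx]; decide)
  obtain ⟨M, a, hM, hMa⟩ := exists_pow_prime_pow_eq_one g Nat.prime_two
  have hMo : Odd M := by rwa [← Nat.not_even_iff_odd, even_iff_two_dvd]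
  obtain ⟨s, hs⟩ := hMo.three_pow_mod_eight
  have hxr : ∀ n : ℤ, x ^ n = 1 ↔ (8 : ℤ) ∣ n := by
    intro n
    rw [← orderOf_dvd_iff_zpow_eq_one, hx]; push_cast; rfl
  have hx8 : x ^ 8 = 1 := by rw [← hx, pow_orderOf_eq_one]
  have hx4 : x ^ 4 ≠ 1 := by
    intro h
    have := orderOf_dvd_of_pow_eq_one h
    rw [hx] at this
    norm_num at this
  rcases hg with hg | hg
  · have hf := conj_pow_eq_zpow_pow hg M
    push_cast at hf
    have hfx : x ^ (3 : ℤ) ^ M = x ^ 3 := by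
      have : (3 : ℤ) ^ M = 3 + 8 * s := by linarith
      rw [this, zpow_add, (hxr (8 * s)).mpr ⟨s, rfl⟩, mul_one]
      exact zpow_natCast x 3
    rw [hfx] at hf
    generalize g ^ M = h at hf hMa
    have hnc : ¬ Commute h x := by
      intro hc
      rw [hc.eq, mul_inv_cancel_right] at hf
      have : x ^ (2 : ℤ) = 1 := by
        have h1 : x * 1 = x * x ^ 2 := by rw [mul_one, ← pow_succ']; exact hf
        exact (zpow_natCast x 2).trans (mul_left_cancel h1).symm
      rw [hxr] at this
      norm_num at this
    have hh4 : h ^ 4 = 1 := by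
      by_contra hh4
      have h1 : h * x ^ 2 * h⁻¹ = (x ^ 2) ^ (3 : ℤ) := by
        rw [← conj_pow, hf]; group
      have := hP.zpow_sub_one_eq_one Nat.prime_two hMa (l := 2)
        (by rw [← pow_mul]; exact hx8) h1 (by norm_num)
        (by norm_num; rw [← pow_mul]; exact_mod_cast hx8) (Or.inr (Or.inr hh4))
      norm_num at this
      rw [← pow_mul] at this
      exact hx4 this
    have hz2 : (x ^ 4) ^ 2 = 1 := by rw [← pow_mul]; exact hx8
    have hcomm : ∀ y : H, y ^ 2 = 1 → Commute y x := by
      intro y hy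
      exact (hI.commute hy x).symm
    rcases hI (h ^ 2) (x ^ 4) hx4 hz2 (by rw [← pow_mul]; exact hh4) with h2 | h2
    · exact hnc (hcomm h h2)
    · have h3 : (x * h) ^ 2 = 1 := by
        calc (x * h) ^ 2 = x * (h * x * h⁻¹) * h ^ 2 := by simp [pow_two, mul_assoc]
          _ = x ^ 8 := by rw [hf, h2]; group
          _ = 1 := hx8
      have h4 := hcomm _ h3
      apply hnc
      have : h = x⁻¹ * (x * h) := by group
      rw [this]
      exact (Commute.refl x).inv_left.mul_left h4
  · have hf := conj_pow_eq_zpow_pow hg M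
    have hM3 : (-((3 : ℕ) : ℤ)) ^ M = -3 - 8 * s := by
      rw [hMo.neg_pow]; push_cast; linarith
    rw [hM3] at hf
    have := hP.zpow_sub_one_eq_one Nat.prime_two hMa (l := 3) hx8 hf
      ⟨-2 - 4 * s, by push_cast; ring⟩
      ((hxr _).mpr ⟨-1 - 2 * s, by push_cast; ring⟩) (Or.inr (Or.inl hx4))
    rw [hxr] at this
    omega

theorem MagnusProperty.prime_le_three [Finite H] (hH : MagnusProperty H)
    (hP : CommutingPrimeCyclic H) (hK : PrimeOrderCentralizes H) (hI : AtMostOneInvolution H)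
    {q : ℕ} (hq : q.Prime) (hqH : q ∣ Nat.card H) : q ≤ 3 := by
  by_contra! hq3
  obtain ⟨b, hb⟩ := exists_prime_orderOf_dvd_card' q hqH (hp := ⟨hq⟩)
  have hq2 : q.Coprime 2 := (Nat.coprime_primes hq Nat.prime_two).mpr (by omega)
  have h3q : q.Coprime 3 := (Nat.coprime_primes hq Nat.prime_three).mpr (by omega)
  obtain ⟨g, t, hg, ht⟩ : ∃ (g : H) (t : ℤ), g * b * g⁻¹ = b ^ t ∧ t ^ 2 = 4 := by
    obtain ⟨g, hg⟩ := hH.exists_conj_pow (x := b) (k := 2) (by rwa [hb])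
    rcases hg with hg | hg
    · exact ⟨g, _, hg, by norm_num⟩
    · exact ⟨g, _, hg, by norm_num⟩
  set d := MulAction.period (MulAut.conj g) b with hd
  have hdc : ∀ n : ℕ, d ∣ n ↔ Commute (g ^ n) b := by
    intro n
    rw [hd, ← MulAction.pow_smul_eq_iff_period_dvd, ← map_pow, MulAut.smul_def,
      MulAut.conj_apply, mul_inv_eq_iff_eq_mul]
    rfl
  have hd2 : ¬ d ∣ 2 := by
    rw [hdc]
    intro hc
    have h1 := conj_pow_eq_zpow_pow hg 2
    rw [ht, hc.eq, mul_inv_cancel_right] at h1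
    have h2 : b ^ 3 = 1 := by
      have h1 : b * 1 = b * b ^ 3 := by rw [mul_one, ← pow_succ']; exact h1.trans (zpow_natCast b 4)
      exact (mul_left_cancel h1).symm
    have := orderOf_dvd_of_pow_eq_one h2
    rw [hb] at this
    have := Nat.le_of_dvd (by norm_num) this
    omega
  have hdr : ∀ r : ℕ, r.Prime → r ∣ d → r * d ∣ orderOf g := by
    intro r hr hrd
    have hdo : d ∣ orderOf g := by
      rw [hdc, pow_orderOf_eq_one]; exact Commute.one_left b
    obtain ⟨m, hm⟩ := hrd.trans hdo
    have h1 : d ∣ m := by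
      rw [hdc]
      refine hK r b (g ^ m) hr (by rw [← pow_mul, mul_comm, ← hm, pow_orderOf_eq_one]) ?_
      rw [conj_pow_eq_zpow_pow hg]
      exact Subgroup.zpow_mem_zpowers b _
    rw [hm]
    exact Nat.mul_dvd_mul_left r h1
  have hord : ∀ n, n ∣ orderOf g → ∃ y : H, orderOf y = n := fun n hn =>
    ⟨_, orderOf_pow_orderOf_div (orderOf_pos g).ne' hn⟩
  rcases Nat.eq_two_pow_or_exists_odd_prime_and_dvd d with ⟨k, hk⟩ | ⟨r, hr, hrd, hro⟩
  · have hk2 : 2 ≤ k := by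
      by_contra hk2
      apply hd2
      rw [hk]
      exact pow_dvd_pow 2 (by omega : k ≤ 1)
    have h4 : 2 ^ 2 ∣ d := hk ▸ pow_dvd_pow 2 hk2
    obtain ⟨y, hy⟩ := hord 8 ((Nat.mul_dvd_mul_left 2 h4).trans
      (hdr 2 Nat.prime_two ((dvd_pow_self 2 two_ne_zero).trans h4)))
    exact hH.orderOf_ne_eight hP hI y hy
  · obtain ⟨y, hy⟩ := hord (r ^ 2)
      ((sq r ▸ Nat.mul_dvd_mul_left r hrd : r ^ 2 ∣ r * d).trans (hdr r hr hrd))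
    exact hH.orderOf_ne_sq hP hr (by rintro rfl; exact absurd hro (by decide)) y hy

end Orders

section Sylow

variable {H : Type*} [Group H]

theorem pow_prime_pow_eq_one_of_orderOf_ne [Finite H] {r m k : ℕ} (hr : r.Prime)
    (h : ∀ x : H, orderOf x ≠ r ^ (m + 1)) {x : H} (hx : x ^ r ^ k = 1) : x ^ r ^ m = 1 := by
  obtain ⟨j, -, hj⟩ := (Nat.dvd_prime_pow hr).mp (orderOf_dvd_of_pow_eq_one hx)
  rw [← orderOf_dvd_iff_pow_eq_one, hj]
  apply pow_dvd_pow
  by_contra! hmj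
  have hd : r ^ (m + 1) ∣ orderOf x := hj ▸ pow_dvd_pow r hmj
  exact h _ (orderOf_pow_orderOf_div (orderOf_pos x).ne' hd)

theorem CommutingPrimeCyclic.card_le_of_isPGroup [Finite H] (hP : CommutingPrimeCyclic H) {r : ℕ}
    (hr : r.Prime) {S : Subgroup H} (hS : IsPGroup r S) (hexp : ∀ y ∈ S, y ^ r = 1) :
    Nat.card S ≤ r := by
  have : Fact r.Prime := ⟨hr⟩
  cases subsingleton_or_nontrivial S with
  | inl h => rw [Nat.card_of_subsingleton (1 : S)]; exact hr.one_le
  | inr h =>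
    have := hS.center_nontrivial
    obtain ⟨⟨⟨z, hzS⟩, hz⟩, hz1⟩ := exists_ne (1 : Subgroup.center S)
    have hz1 : z ≠ 1 := by
      rintro rfl
      exact hz1 rfl
    have hle : S ≤ Subgroup.zpowers z := by
      intro y hy
      refine hP r z y hr hz1 (hexp z hzS) (hexp y hy) ?_
      have := (Subgroup.mem_center_iff.mp hz) ⟨y, hy⟩
      exact (congrArg Subtype.val this).symm
    calc Nat.card S ≤ Nat.card (Subgroup.zpowers z) := Subgroup.card_le_of_le hle
      _ = orderOf z := Nat.card_zpowers z
      _ ≤ r := orderOf_le_of_pow_eq_one hr.pos (hexp z hzS)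

theorem AtMostOneInvolution.mem_zpowers_of_commute (hI : AtMostOneInvolution H) {x y : H}
    (hx4 : x ^ 4 = 1) (hx2 : x ^ 2 ≠ 1) (hy4 : y ^ 4 = 1) (h : Commute x y) :
    y ∈ Subgroup.zpowers x := by
  have hxx : (x ^ 2) ^ 2 = 1 := by rw [← pow_mul]; exact hx4
  rcases hI (y ^ 2) (x ^ 2) hx2 hxx (by rw [← pow_mul]; exact hy4) with hy | hy
  · rcases hI y (x ^ 2) hx2 hxx hy with rfl | rfl
    · exact one_mem _
    · exact Subgroup.npow_mem_zpowers x 2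
  · rcases hI (x * y) (x ^ 2) hx2 hxx (by rw [h.mul_pow, hy, ← pow_add]; exact hx4) with h1 | h1
    · rw [← inv_eq_of_mul_eq_one_right h1]
      exact inv_mem (Subgroup.mem_zpowers x)
    · rw [pow_two] at h1
      rw [mul_left_cancel h1]
      exact Subgroup.mem_zpowers x

theorem AtMostOneInvolution.conj_eq_or_eq_inv (hI : AtMostOneInvolution H) {x y : H}
    (hx4 : x ^ 4 = 1) (hx2 : x ^ 2 ≠ 1) (hy4 : y ^ 4 = 1) (hxy : (x * y) ^ 4 = 1) :
    y * x * y⁻¹ = x ∨ y * x * y⁻¹ = x⁻¹ := by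
  have hxx : (x ^ 2) ^ 2 = 1 := by rw [← pow_mul]; exact hx4
  have key : y * x * y⁻¹ = x⁻¹ * (x * y) ^ 2 * (y ^ 2)⁻¹ := by simp [pow_two, mul_assoc]
  have hinv : x⁻¹ * (x ^ 2)⁻¹ = x := by
    rw [← mul_inv_rev, ← pow_succ, inv_eq_iff_mul_eq_one, ← pow_succ, hx4]
  have hsq : x⁻¹ * x ^ 2 = x := by group
  rw [key]
  rcases hI ((x * y) ^ 2) (x ^ 2) hx2 hxx (by rw [← pow_mul]; exact hxy) with h1 | h1 <;>
  rcases hI (y ^ 2) (x ^ 2) hx2 hxx (by rw [← pow_mul]; exact hy4) with h2 | h2 <;>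
  rw [h1, h2]
  · right; simp
  · left; rw [mul_one, hinv]
  · left; rw [inv_one, mul_one, hsq]
  · right; rw [mul_assoc, mul_inv_cancel, mul_one]

theorem AtMostOneInvolution.card_le_eight [Finite H] (hI : AtMostOneInvolution H)
    {S : Subgroup H} (hexp : ∀ y ∈ S, y ^ 4 = 1) : Nat.card S ≤ 8 := by
  by_cases hS : ∃ x ∈ S, x ^ 2 ≠ 1
  · obtain ⟨x, hxS, hx2⟩ := hS
    have hx4 := hexp x hxS
    have hsub : ∃ y₀ : H, (S : Set H) ⊆ (Subgroup.zpowers x : Set H) ∪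
        (y₀ * ·) '' (Subgroup.zpowers x : Set H) := by
      by_cases hc : ∃ y₀ ∈ S, ¬ Commute x y₀
      · obtain ⟨y₀, hy₀S, hy₀⟩ := hc
        have hcase : ∀ y ∈ S, ¬ Commute x y → y * x * y⁻¹ = x⁻¹ := by
          intro y hy hxy
          refine (hI.conj_eq_or_eq_inv hx4 hx2 (hexp y hy)
            (hexp _ (mul_mem hxS hy))).resolve_left ?_
          intro h
          exact hxy (mul_inv_eq_iff_eq_mul.mp h).symm
        refine ⟨y₀, fun y hy => ?_⟩
        by_cases hxy : Commute x y
        · exact Or.inl (hI.mem_zpowers_of_commute hx4 hx2 (hexp y hy) hxy)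
        · right
          have hm : y₀⁻¹ * y ∈ S := mul_mem (inv_mem hy₀S) hy
          refine ⟨y₀⁻¹ * y, hI.mem_zpowers_of_commute hx4 hx2 (hexp _ hm) ?_, by simp⟩
          have h1 := hcase y hy hxy
          rw [← hcase y₀ hy₀S hy₀, mul_inv_eq_iff_eq_mul] at h1
          have h2 : y₀⁻¹ * (y * x) = y₀⁻¹ * (y₀ * x * y₀⁻¹ * y) := by rw [h1]
          have h3 : y₀⁻¹ * y * x = x * (y₀⁻¹ * y) := by
            rw [mul_assoc, h2]; group
          exact h3.symm
      · push Not at hc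
        exact ⟨1, fun y hy => Or.inl
          (hI.mem_zpowers_of_commute hx4 hx2 (hexp y hy) (hc y hy))⟩
    obtain ⟨y₀, hy₀⟩ := hsub
    have hz : (Subgroup.zpowers x : Set H).ncard ≤ 4 := by
      have : (Subgroup.zpowers x : Set H).ncard = orderOf x := Nat.card_zpowers x
      rw [this]
      exact orderOf_le_of_pow_eq_one (by norm_num) hx4
    calc Nat.card S = (S : Set H).ncard := rfl
      _ ≤ _ := Set.ncard_le_ncard hy₀ (Set.toFinite _)
      _ ≤ _ := Set.ncard_union_le _ _
      _ ≤ 4 + 4 := Nat.add_le_add hz ((Set.ncard_image_le (Set.toFinite _)).trans hz)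
  · push Not at hS
    by_cases hz : ∃ z ∈ S, z ≠ 1
    · obtain ⟨z, hzS, hz1⟩ := hz
      have hsub : (S : Set H) ⊆ {1, z} := fun y hy => hI y z hz1 (hS z hzS) (hS y hy)
      calc Nat.card S = (S : Set H).ncard := rfl
        _ ≤ _ := Set.ncard_le_ncard hsub (Set.toFinite _)
        _ ≤ 2 := (Set.ncard_insert_le _ _).trans (by simp)
        _ ≤ 8 := by norm_num
    · push Not at hz
      rw [(Subgroup.eq_bot_iff_forall S).mpr hz]
      simp

theorem MagnusProperty.pow_four_of_isPGroup [Finite H] (hH : MagnusProperty H)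
    (hP : CommutingPrimeCyclic H) (hI : AtMostOneInvolution H) {S : Subgroup H}
    (hS : IsPGroup 2 S) {y : H} (hy : y ∈ S) : y ^ 4 = 1 := by
  obtain ⟨k, hk⟩ := hS ⟨y, hy⟩
  exact pow_prime_pow_eq_one_of_orderOf_ne Nat.prime_two (m := 2)
    (hH.orderOf_ne_eight hP hI) (congrArg Subtype.val hk)

theorem MagnusProperty.card_dvd_twentyFour [Finite H] (hH : MagnusProperty H)
    (hP : CommutingPrimeCyclic H) (hK : PrimeOrderCentralizes H) (hI : AtMostOneInvolution H) :
    Nat.card H ∣ 24 := by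
  rw [← Nat.factorization_le_iff_dvd Nat.card_pos.ne' (by norm_num)]
  intro p
  by_cases hp : p.Prime
  · by_cases hpH : p ∣ Nat.card H
    · have hp3 := hH.prime_le_three hP hK hI hp hpH
      have : Fact p.Prime := ⟨hp⟩
      obtain ⟨S⟩ : Nonempty (Sylow p H) := inferInstance
      have hcard := S.card_eq_multiplicity
      have hp2 := hp.two_le
      suffices ∀ n, p ^ n ∣ 24 → Nat.card S ≤ p ^ n →
          (Nat.card H).factorization p ≤ (24 : ℕ).factorization p by
        obtain rfl | rfl : p = 2 ∨ p = 3 := by omega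
        · exact this 3 (by norm_num)
            (hI.card_le_eight fun y hy => hH.pow_four_of_isPGroup hP hI S.isPGroup' hy)
        · refine this 1 (by norm_num) (hP.card_le_of_isPGroup hp S.isPGroup' fun y hy => ?_)
          obtain ⟨k, hk⟩ := S.isPGroup' ⟨y, hy⟩
          exact pow_prime_pow_eq_one_of_orderOf_ne hp (m := 1)
            (hH.orderOf_ne_sq hP hp (by norm_num)) (congrArg Subtype.val hk)
      intro n hn hle
      rw [hcard] at hle
      exact ((Nat.pow_le_pow_iff_right hp.one_lt).mp hle).trans
        ((hp.pow_dvd_iff_le_factorization (by norm_num)).mp hn)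
    · rw [Nat.factorization_eq_zero_of_not_dvd hpH]; exact Nat.zero_le _
  · rw [Nat.factorization_eq_zero_of_not_prime _ hp]; exact Nat.zero_le _

end Sylow

section Exclusion

variable {H : Type*} [Group H]

theorem AtMostOneInvolution.exists_sq_ne_one (hI : AtMostOneInvolution H) {S : Subgroup H}
    [Finite H] (hS : 2 < Nat.card S) : ∃ x ∈ S, x ^ 2 ≠ 1 := by
  by_contra! h
  have hsub : ∃ z, (S : Set H) ⊆ {1, z} := by
    by_cases hz : ∃ z ∈ S, z ≠ 1
    · obtain ⟨z, hzS, hz1⟩ := hz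
      exact ⟨z, fun y hy => hI y z hz1 (h z hzS) (h y hy)⟩
    · push Not at hz
      exact ⟨1, fun y hy => Or.inl (hz y hy)⟩
  obtain ⟨z, hz⟩ := hsub
  have : Nat.card S ≤ 2 := by
    calc Nat.card S = (S : Set H).ncard := rfl
      _ ≤ _ := Set.ncard_le_ncard hz (Set.toFinite _)
      _ ≤ 2 := (Set.ncard_insert_le _ _).trans (by simp)
  omega

theorem MagnusProperty.exists_conj_of_order_twelve [Finite H] (hH : MagnusProperty H) {b c : H}
    (hb : b ^ 3 = 1) (hc : c ^ 4 = 1) (hbc : Commute c b) :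
    ∃ h, (Commute h c ∧ h * b * h⁻¹ = b⁻¹) ∨ (h * c * h⁻¹ = c⁻¹ ∧ Commute h b) := by
  have ha : (c * b) ^ 12 = 1 := by
    rw [hbc.mul_pow, pow_mul c 4 3, pow_mul b 3 4, hb, hc]; simp
  have hcop : (orderOf (c * b)).Coprime 5 :=
    Nat.Coprime.coprime_dvd_left (orderOf_dvd_of_pow_eq_one ha) (by norm_num)
  have h9 : (c * b) ^ 9 = c := by
    rw [hbc.mul_pow, pow_mul b 3 3, hb, pow_succ c 8, pow_mul c 4 2, hc]; simp
  have h4 : (c * b) ^ 4 = b := by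
    rw [hbc.mul_pow, hc, pow_succ b 3, hb]; simp
  have hb2 : b ^ 2 = b⁻¹ := by rw [eq_inv_iff_mul_eq_one, ← pow_succ]; exact hb
  have hc3 : c ^ 3 = c⁻¹ := by rw [eq_inv_iff_mul_eq_one, ← pow_succ]; exact hc
  obtain ⟨h, hh⟩ := hH.exists_conj_pow hcop
  refine ⟨h, ?_⟩
  have e1 : ∀ n : ℕ, h * (c * b) ^ n * h⁻¹ = (h * (c * b) * h⁻¹) ^ n := fun n => conj_pow.symm
  have f1 := e1 9
  have f2 := e1 4
  rw [h9] at f1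
  rw [h4] at f2
  have hc5 : c ^ 5 = c := by rw [pow_succ c 4, hc, one_mul]
  have hb5 : b ^ 5 = b⁻¹ := by rw [pow_add b 3 2, hb, one_mul, hb2]
  have g9 : ((c * b) ^ 5) ^ 9 = c := by rw [← pow_mul, mul_comm, pow_mul, h9, hc5]
  have g4 : ((c * b) ^ 5) ^ 4 = b⁻¹ := by rw [← pow_mul, mul_comm, pow_mul, h4, hb5]
  have hz : (c * b) ^ ((5 : ℕ) : ℤ) = (c * b) ^ 5 := zpow_natCast _ 5
  rcases hh with hh | hh
  · left
    rw [hh, hz] at f1 f2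
    rw [g9] at f1
    rw [g4] at f2
    exact ⟨mul_inv_eq_iff_eq_mul.mp f1, f2⟩
  · right
    rw [hh, zpow_neg, hz, inv_pow] at f1 f2
    rw [g9] at f1
    rw [g4, inv_inv] at f2
    exact ⟨f1, mul_inv_eq_iff_eq_mul.mp f2⟩

theorem MagnusProperty.card_ne_twelve [Finite H] (hH : MagnusProperty H)
    (hP : CommutingPrimeCyclic H) (hI : AtMostOneInvolution H)
    (hcomm : ∀ g h : H, Commute g h) : Nat.card H ≠ 12 := by
  intro hcard
  obtain ⟨b, hb⟩ := exists_prime_orderOf_dvd_card' 3 (G := H) (by rw [hcard]; norm_num)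
  have hb3 : b ^ 3 = 1 := hb ▸ pow_orderOf_eq_one b
  obtain ⟨S, hS⟩ := Sylow.exists_subgroup_card_pow_prime (G := H) 2 (n := 2)
    (by rw [hcard]; norm_num)
  have hS2 := IsPGroup.of_card hS
  norm_num at hS
  obtain ⟨c, hcS, hc2⟩ := hI.exists_sq_ne_one (S := S) (by omega)
  obtain ⟨h, ⟨-, hh⟩ | ⟨hh, -⟩⟩ := hH.exists_conj_of_order_twelve hb3
    (hH.pow_four_of_isPGroup hP hI hS2 hcS) (hcomm c b)
  · rw [(hcomm h b).eq, mul_inv_cancel_right, eq_inv_iff_mul_eq_one, ← pow_two] at hh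
    have := orderOf_dvd_of_pow_eq_one hh
    rw [hb] at this
    norm_num at this
  · rw [(hcomm h c).eq, mul_inv_cancel_right, eq_inv_iff_mul_eq_one, ← pow_two] at hh
    exact hc2 hh

theorem MagnusProperty.involution_notMem_normalClosure (hH : MagnusProperty H)
    (hI : AtMostOneInvolution H) {b z : H} (hb : b ^ 3 = 1) (hz : z ≠ 1) (hz2 : z ^ 2 = 1) :
    z ∉ Subgroup.normalClosure {b} := by
  intro hmem
  have hbz := hI.commute hz2 b
  have hbN : b ∈ Subgroup.normalClosure {b} := Subgroup.subset_normalClosure (Set.mem_singleton b)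
  have hbzN : b * z ∈ Subgroup.normalClosure {b * z} :=
    Subgroup.subset_normalClosure (Set.mem_singleton _)
  obtain ⟨g, hg⟩ := hH.exists_conj (x := b) (y := b * z) (by
    apply le_antisymm <;> apply Subgroup.normalClosure_le_normal <;>
      rw [Set.singleton_subset_iff]
    · have h4 : (b * z) ^ 4 = b := by
        rw [hbz.mul_pow, pow_succ b 3, hb, one_mul, pow_mul z 2 2, hz2]; simp
      have := pow_mem hbzN 4
      rwa [h4] at this
    · exact mul_mem hbN hmem)
  have h3 : (b * z) ^ 3 = z := by rw [hbz.mul_pow, hb, pow_succ z 2, hz2]; simp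
  have h1 : (g * b * g⁻¹) ^ 3 = 1 := by rw [conj_pow, hb]; simp
  rcases hg with hg | hg
  · rw [hg, h3] at h1; exact hz h1
  · rw [hg, inv_pow, h3, inv_eq_one] at h1; exact hz h1

theorem MagnusProperty.conj_order_three [Finite H] (hH : MagnusProperty H)
    (hI : AtMostOneInvolution H) (hcard : Nat.card H = 24) {b : H} (hb : orderOf b = 3) (g : H) :
    Commute g b ∨ g * b * g⁻¹ = b⁻¹ := by
  have hb3 : b ^ 3 = 1 := hb ▸ pow_orderOf_eq_one b
  set N := Subgroup.normalClosure {b} with hN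
  have hbN : b ∈ N := Subgroup.subset_normalClosure (Set.mem_singleton b)
  have h2N : ¬ 2 ∣ Nat.card N := by
    intro h2
    obtain ⟨⟨z, hzN⟩, hz⟩ := exists_prime_orderOf_dvd_card' 2 h2
    rw [Subgroup.orderOf_mk] at hz
    refine hH.involution_notMem_normalClosure hI hb3 (z := z) ?_ (hz ▸ pow_orderOf_eq_one z) hzN
    rintro rfl
    simp at hz
  have hN3 : Nat.card N ∣ 3 := by
    have h24 : Nat.card N ∣ 2 ^ 3 * 3 := by
      have := Subgroup.card_subgroup_dvd_card N
      rwa [hcard] at this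
    exact (((Nat.Prime.coprime_iff_not_dvd Nat.prime_two).mpr h2N).symm.pow_right
      3).dvd_of_dvd_mul_left h24
  have hle : Subgroup.zpowers b = N := by
    apply Subgroup.eq_of_le_of_card_ge (Subgroup.zpowers_le.mpr hbN)
    rw [Nat.card_zpowers, hb]
    exact Nat.le_of_dvd (by norm_num) hN3
  have hgb : g * b * g⁻¹ ∈ Subgroup.zpowers b := by
    rw [hle]
    exact Subgroup.normalClosure_normal.conj_mem b hbN g
  classical
  rw [← mem_powers_iff_mem_zpowers, mem_powers_iff_mem_range_orderOf, hb] at hgb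
  simp only [Finset.mem_image, Finset.mem_range] at hgb
  obtain ⟨n, hn, hgn⟩ := hgb
  interval_cases n
  · rw [pow_zero, eq_comm, conj_eq_one_iff] at hgn
    rw [hgn]
    exact Or.inl (Commute.one_right g)
  · left
    rw [pow_one] at hgn
    exact mul_inv_eq_iff_eq_mul.mp hgn.symm
  · right
    rw [← hgn, eq_inv_iff_mul_eq_one, ← pow_succ]
    exact hb3

theorem MagnusProperty.card_ne_twentyFour [Finite H] (hH : MagnusProperty H)
    (hP : CommutingPrimeCyclic H) (hI : AtMostOneInvolution H)
    (hcomm : ∀ b g h : H, orderOf b = 3 → Commute g b → Commute h b → Commute g h) :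
    Nat.card H ≠ 24 := by
  intro hcard
  obtain ⟨b, hb⟩ := exists_prime_orderOf_dvd_card' 3 (G := H) (by rw [hcard]; norm_num)
  have hb3 : b ^ 3 = 1 := hb ▸ pow_orderOf_eq_one b
  have hcase := hH.conj_order_three hI hcard hb
  have hprod : ∀ g h : H, ¬ Commute g b → ¬ Commute h b → Commute (g⁻¹ * h) b := by
    intro g h hg hh
    have h1 := (hcase g).resolve_left hg
    have h2 := (hcase h).resolve_left hh
    rw [← h1, mul_inv_eq_iff_eq_mul] at h2
    calc g⁻¹ * h * b = g⁻¹ * (h * b) := mul_assoc _ _ _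
      _ = b * (g⁻¹ * h) := by rw [h2]; group
  obtain ⟨S, hS⟩ := Sylow.exists_subgroup_card_pow_prime (G := H) 2 (n := 3)
    (by rw [hcard]; norm_num)
  have hS2 := IsPGroup.of_card hS
  norm_num at hS
  have hS4 : ∀ y ∈ S, y ^ 4 = 1 := fun y hy => hH.pow_four_of_isPGroup hP hI hS2 hy
  have hSx : ∀ x : H, x ^ 4 = 1 → ∃ y ∈ S, y ∉ Subgroup.zpowers x := by
    intro x hx
    by_contra! hle
    have h1 : Nat.card S ≤ Nat.card (Subgroup.zpowers x) := Subgroup.card_le_of_le hle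
    rw [hS, Nat.card_zpowers] at h1
    have := orderOf_le_of_pow_eq_one (by norm_num) hx
    omega
  obtain ⟨c, hcS, hc2, hcb⟩ : ∃ c ∈ S, c ^ 2 ≠ 1 ∧ Commute c b := by
    let C := Subgroup.centralizer {b} ⊓ S
    have hC : ∀ y, y ∈ C ↔ Commute y b ∧ y ∈ S := by
      intro y
      rw [Subgroup.mem_inf, Subgroup.mem_centralizer_singleton_iff]
      rfl
    have hC2 : 2 < Nat.card C := by
      by_contra! hle
      have hsub : ∃ g, (S : Set H) ⊆ (C : Set H) ∪ (g * ·) '' (C : Set H) := by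
        by_cases hg : ∃ g ∈ S, ¬ Commute g b
        · obtain ⟨g, hgS, hg⟩ := hg
          refine ⟨g, fun y hy => ?_⟩
          by_cases hyb : Commute y b
          · exact Or.inl ((hC y).mpr ⟨hyb, hy⟩)
          · exact Or.inr ⟨g⁻¹ * y,
              (hC _).mpr ⟨hprod g y hg hyb, mul_mem (inv_mem hgS) hy⟩, by simp⟩
        · push Not at hg
          exact ⟨1, fun y hy => Or.inl ((hC y).mpr ⟨hg y hy, hy⟩)⟩
      obtain ⟨g, hg⟩ := hsub
      have hle' : (C : Set H).ncard ≤ 2 := hle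
      have : Nat.card S ≤ 2 + 2 := by
        calc Nat.card S = (S : Set H).ncard := rfl
          _ ≤ _ := Set.ncard_le_ncard hg (Set.toFinite _)
          _ ≤ _ := Set.ncard_union_le _ _
          _ ≤ 2 + 2 := Nat.add_le_add hle' ((Set.ncard_image_le (Set.toFinite _)).trans hle')
      omega
    obtain ⟨c, hcC, hc2⟩ := hI.exists_sq_ne_one hC2
    exact ⟨c, ((hC c).mp hcC).2, hc2, ((hC c).mp hcC).1⟩
  have hc4 := hS4 c hcS
  obtain ⟨h, ⟨hhc, hhb⟩ | ⟨hhc, hhb⟩⟩ := hH.exists_conj_of_order_twelve hb3 hc4 hcb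
  · have hnb : ¬ Commute h b := by
      intro hc
      rw [hc.eq, mul_inv_cancel_right, eq_inv_iff_mul_eq_one, ← pow_two] at hhb
      have := orderOf_dvd_of_pow_eq_one hhb
      rw [hb] at this
      norm_num at this
    obtain ⟨y, hyS, hy⟩ := hSx c hc4
    apply hy
    refine hI.mem_zpowers_of_commute hc4 hc2 (hS4 y hyS) ?_
    by_cases hyb : Commute y b
    · exact hcomm b c y hb hcb hyb
    · have h1 := hcomm b c _ hb hcb (hprod h y hnb hyb)
      have : y = h * (h⁻¹ * y) := by group
      rw [this]
      exact hhc.symm.mul_right h1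
  · rw [(hcomm b h c hb hhb hcb).eq, mul_inv_cancel_right, eq_inv_iff_mul_eq_one, ← pow_two] at hhc
    exact hc2 hhc

end Exclusion

namespace IsSemiregularAction

variable {H V : Type*} [Group H] [AddCommGroup V] {ρ : H →* AddMonoid.End V}

theorem commute_of_closure_eq_top [Nontrivial V] (hρ : IsSemiregularAction ρ) {b g h : H} {v : V}
    (hv : AddSubgroup.closure {v, ρ b v} = ⊤) (hg : Commute g b) (hh : Commute h b) :
    Commute g h := by
  have key : ∀ k : H, Commute k b → ∃ i j : ℤ, ρ k = i • 1 + j • ρ b := by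
    intro k hk
    have hmem : ρ k v ∈ AddSubgroup.closure {v, ρ b v} := hv ▸ AddSubgroup.mem_top _
    obtain ⟨i, j, hij⟩ := AddSubgroup.mem_closure_pair.mp hmem
    refine ⟨i, j, ?_⟩
    refine AddMonoidHom.eq_of_eqOn_dense hv ?_
    have hkb : ρ k (ρ b v) = ρ b (ρ k v) := by
      have := DFunLike.congr_fun (hk.map ρ).eq v
      exact this
    rintro w (rfl | rfl)
    · exact hij.symm
    · change ρ k (ρ b v) = i • ρ b v + j • ρ b (ρ b v)
      rw [hkb, ← hij, map_add, map_zsmul, map_zsmul]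
  obtain ⟨i, j, hk⟩ := key g hg
  obtain ⟨i', j', hk'⟩ := key h hh
  have : Commute (ρ g) (ρ h) := by
    rw [hk, hk']
    have hb := Commute.refl (ρ b)
    have h1 := Commute.one_left (ρ b)
    refine Commute.add_left (Commute.add_right ?_ ?_) (Commute.add_right ?_ ?_)
    · exact ((Commute.one_left _).smul_left i)
    · exact ((Commute.one_left _).smul_left i)
    · exact ((Commute.one_right _).smul_right i')
    · exact (hb.smul_left j).smul_right j'
  apply hρ.injective
  rw [map_mul, map_mul]
  exact this.eq

theorem closure_eq_top_of_card_twentyFive (hρ : IsSemiregularAction ρ) (hV : Nat.card V = 25)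
    {b : H} (hb : orderOf b = 3) {v : V} (hv : v ≠ 0) :
    AddSubgroup.closure {v, ρ b v} = ⊤ := by
  have : Finite V := Nat.finite_of_card_ne_zero (by omega)
  set W := AddSubgroup.closure {v, ρ b v} with hW
  have hvW : v ∈ W := AddSubgroup.subset_closure (by simp)
  have hbvW : ρ b v ∈ W := AddSubgroup.subset_closure (by simp)
  have hcard : Nat.card W ∣ 5 ^ 2 := by
    have := AddSubgroup.card_addSubgroup_dvd_card W
    rwa [hV] at this
  have hv1 : addOrderOf v ≠ 1 := by rwa [ne_eq, AddMonoid.addOrderOf_eq_one_iff]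
  have hvd : addOrderOf v ∣ Nat.card W := by
    rw [← Nat.card_zmultiples]
    exact AddSubgroup.card_dvd_of_le (AddSubgroup.zmultiples_le_of_mem hvW)
  obtain ⟨k, hk, hWk⟩ := (Nat.dvd_prime_pow Nat.prime_five).mp hcard
  interval_cases k
  · rw [hWk] at hvd
    exact absurd (Nat.dvd_one.mp hvd) hv1
  · exfalso
    rw [hWk, pow_one] at hvd
    have hv5 := ((Nat.dvd_prime Nat.prime_five).mp hvd).resolve_left hv1
    have hZ : AddSubgroup.zmultiples v = W := by
      apply AddSubgroup.eq_of_le_of_card_ge (AddSubgroup.zmultiples_le_of_mem hvW)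
      rw [Nat.card_zmultiples, hv5, hWk, pow_one]
    rw [← hZ] at hbvW
    obtain ⟨n, hn⟩ := AddSubgroup.mem_zmultiples_iff.mp hbvW
    have hb1 : b ≠ 1 := by
      rintro rfl
      simp at hb
    have hsum := DFunLike.congr_fun (hρ.sum_pow_eq_zero hb1 (hb ▸ pow_orderOf_eq_one b)) v
    have hsum' : v + ρ b v + ρ b (ρ b v) = 0 := by
      rw [Finset.sum_range_succ, Finset.sum_range_succ, Finset.sum_range_one, pow_zero, pow_one,
        pow_two] at hsum
      exact hsum
    rw [← hn, map_zsmul, ← hn] at hsum'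
    have h0 : (1 + n + n * n) • v = 0 := by
      rw [add_zsmul, add_zsmul, one_zsmul, mul_zsmul]
      exact hsum'
    rw [← addOrderOf_dvd_iff_zsmul_eq_zero, hv5] at h0
    have h1 : ((1 + n + n * n : ℤ) : ZMod 5) = 0 := (ZMod.intCast_zmod_eq_zero_iff_dvd _ 5).mpr h0
    push_cast at h1
    generalize (n : ZMod 5) = m at h1
    revert m
    decide
  · apply AddSubgroup.eq_top_of_card_eq
    rw [hWk, hV]
    norm_num

/-- The possible orders of a group on which a finite group with the Magnus property acts
semiregularly with one orbit, or two orbits interchanged by inversion, of nonzero elements. -/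
theorem card_mem [Finite H] [Finite V] [Nontrivial V] (hρ : IsSemiregularAction ρ)
    (hH : MagnusProperty H)
    (hcard : Nat.card V = Nat.card H + 1 ∨ Odd (Nat.card H) ∧ Nat.card V = 2 * Nat.card H + 1) :
    Nat.card V ∈ ({2, 3, 4, 5, 7, 9} : Set ℕ) := by
  have hco : (Nat.card H).Coprime (Nat.card V) := by
    rcases hcard with h | ⟨-, h⟩ <;> rw [h] <;> simp
  have hP := hρ.commutingPrimeCyclic hco
  have hK := hρ.primeOrderCentralizes hco
  have hI : AtMostOneInvolution H := fun y z hz hz2 hy2 => hρ.involution_unique hz hz2 hy2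
  have hdvd := hH.card_dvd_twentyFour hP hK hI
  obtain ⟨v, hv⟩ := exists_ne (0 : V)
  have h12 : Nat.card V = 13 → Nat.card H ≠ 12 := by
    intro hV
    refine hH.card_ne_twelve hP hI fun g h => ?_
    have : Fact (Nat.card V).Prime := ⟨by rw [hV]; norm_num⟩
    refine hρ.commute_of_closure_eq_top (b := 1) (v := v) ?_ (Commute.one_right g)
      (Commute.one_right h)
    rw [map_one]
    change AddSubgroup.closure {v, v} = ⊤
    rw [Set.pair_eq_singleton, ← AddSubgroup.zmultiples_eq_closure]
    exact zmultiples_eq_top_of_prime_card rfl hv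
  have h24 : Nat.card V = 25 → Nat.card H ≠ 24 := by
    intro hV
    refine hH.card_ne_twentyFour hP hI fun b g h hb hg hh => ?_
    exact hρ.commute_of_closure_eq_top (hρ.closure_eq_top_of_card_twentyFive hV hb hv) hg hh
  simp only [Set.mem_insert_iff, Set.mem_singleton_iff]
  generalize Nat.card V = m at hcard h12 h24 ⊢
  generalize Nat.card H = n at hcard h12 h24 hdvd
  have hn : n ∈ Nat.divisors 24 := Nat.mem_divisors.mpr ⟨hdvd, by norm_num⟩
  have hn : n ∈ ({1, 2, 3, 4, 6, 8, 12, 24} : Finset ℕ) := hn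
  simp only [Finset.mem_insert, Finset.mem_singleton] at hn
  rw [Nat.odd_iff] at hcard
  omega

end IsSemiregularAction

theorem IsSemiregularAction.card_eq_of_transitive {H V : Type*} [Group H] [AddCommGroup V]
    {ρ : H →* AddMonoid.End V} [Finite H] [Finite V] [Nontrivial V] (hρ : IsSemiregularAction ρ)
    (htrans : ∀ v w, v ≠ 0 → w ≠ 0 → ∃ h, ρ h v = w ∨ ρ h v = -w) :
    Nat.card V = Nat.card H + 1 ∨ Odd (Nat.card H) ∧ Nat.card V = 2 * Nat.card H + 1 := by
  obtain ⟨v, hv⟩ := exists_ne (0 : V)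
  have hmul : ∀ g h, ρ (g * h) v = ρ g (ρ h v) := fun g h => by rw [map_mul]; rfl
  have hone : ρ 1 v = v := by rw [map_one]; rfl
  have hinj : Function.Injective fun h => ρ h v := by
    intro h k hhk
    have h1 : ρ (k⁻¹ * h) v = v := by
      rw [hmul, show ρ h v = ρ k v from hhk, ← hmul, inv_mul_cancel, hone]
    exact (inv_mul_eq_one.mp ((hρ _ _ h1).resolve_right hv)).symm
  have hne : ∀ h, ρ h v ≠ 0 := by
    intro h h0
    apply hv
    rw [← hone, ← inv_mul_cancel h, hmul, h0, map_zero]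
  have hO : (Set.range fun h => ρ h v).ncard = Nat.card H := by
    rw [← Set.image_univ, Set.ncard_image_of_injective _ hinj, Set.ncard_univ]
  by_cases hneg : ∃ k, ρ k v = -v
  · obtain ⟨k, hk⟩ := hneg
    left
    have huniv : (Set.univ : Set V) = insert 0 (Set.range fun h => ρ h v) := by
      refine (Set.eq_univ_of_forall fun w => ?_).symm
      by_cases hw : w = 0
      · exact Or.inl hw
      · obtain ⟨h, h1 | h1⟩ := htrans v w hv hw
        · exact Or.inr ⟨h, h1⟩
        · exact Or.inr ⟨h * k, by simp only [hmul, hk, map_neg, h1, neg_neg]⟩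
    rw [← Set.ncard_univ, huniv, Set.ncard_insert_of_notMem _ (Set.toFinite _), hO]
    rintro ⟨h, h0⟩
    exact hne h h0
  · right
    constructor
    · rw [← Nat.not_even_iff_odd]
      intro heven
      obtain ⟨z, hz⟩ := exists_prime_orderOf_dvd_card' 2 heven.two_dvd
      obtain ⟨hz2, hz1⟩ := orderOf_eq_prime_iff.mp hz
      exact hneg ⟨z, by rw [hρ.map_involution hz1 hz2]; rfl⟩
    · have huniv : (Set.univ : Set V) = insert 0
          ((Set.range fun h => ρ h v) ∪ Neg.neg '' (Set.range fun h => ρ h v)) := by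
        refine (Set.eq_univ_of_forall fun w => ?_).symm
        by_cases hw : w = 0
        · exact Or.inl hw
        · obtain ⟨h, h1 | h1⟩ := htrans v w hv hw
          · exact Or.inr (Or.inl ⟨h, h1⟩)
          · exact Or.inr (Or.inr ⟨_, ⟨h, h1⟩, neg_neg w⟩)
      have hdisj : Disjoint (Set.range fun h => ρ h v)
          (Neg.neg '' (Set.range fun h => ρ h v)) := by
        rw [Set.disjoint_left]
        rintro _ ⟨h, rfl⟩ ⟨_, ⟨k, rfl⟩, hk⟩
        have hk : -ρ k v = ρ h v := hk
        refine hneg ⟨k⁻¹ * h, ?_⟩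
        rw [hmul, ← hk, map_neg, ← hmul, inv_mul_cancel, hone]
      rw [← Set.ncard_univ, huniv, Set.ncard_insert_of_notMem _ (Set.toFinite _),
        Set.ncard_union_eq hdisj (Set.toFinite _) (Set.toFinite _),
        Set.ncard_image_of_injective _ neg_injective, hO, two_mul]
      rintro (⟨h, h0⟩ | ⟨_, ⟨h, rfl⟩, h0⟩)
      · exact hne h h0
      · exact hne h (neg_eq_zero.mp h0)

section Reduction

variable {G : Type*} [Group G]

open Subgroup
open scoped IsMulCommutative

theorem MagnusProperty.of_surjective [Finite G] (hG : MagnusProperty G) {Q : Type*} [Group Q]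
    (f : G →* Q) (hf : Function.Surjective f) : MagnusProperty Q := by
  intro x y hxy
  have h_preimage : ∀ (a : G) (z : Q), z ∈ normalClosure {f a} →
      ∃ b ∈ normalClosure {a}, f b = z := by
    intro a z hz
    rw [← Set.image_singleton, ← map_normalClosure _ _ hf] at hz
    exact hz
  obtain ⟨a, ha, hmin⟩ := Set.exists_min_image {a : G | f a = x}
    (fun a => Nat.card (normalClosure {a})) (Set.toFinite _) (hf x)
  have ha : f a = x := ha
  subst ha
  obtain ⟨b, hb, rfl⟩ := h_preimage a y (hxy ▸ subset_normalClosure rfl)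
  obtain ⟨c, hc, hca⟩ := h_preimage b (f a) (hxy ▸ subset_normalClosure rfl)
  have hba : normalClosure {b} ≤ normalClosure {a} :=
    normalClosure_le_normal (Set.singleton_subset_iff.mpr hb)
  have hcb : normalClosure {c} ≤ normalClosure {b} :=
    normalClosure_le_normal (Set.singleton_subset_iff.mpr hc)
  have hab : normalClosure {b} = normalClosure {a} :=
    eq_of_le_of_card_ge hba ((hmin c hca).trans (card_le_of_le hcb))
  rcases hG a b hab.symm with h | h
  · exact Or.inl (f.map_isConj h)
  · exact Or.inr (map_inv f b ▸ f.map_isConj h)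

/-- A nontrivial normal subgroup containing no smaller nontrivial normal subgroup. -/
structure IsMinimalNormal (N : Subgroup G) : Prop where
  normal : N.Normal
  ne_bot : N ≠ ⊥
  eq_of_le : ∀ K : Subgroup G, K.Normal → K ≤ N → K ≠ ⊥ → K = N

theorem exists_isMinimalNormal (G : Type*) [Group G] [Finite G] [Nontrivial G] :
    ∃ N : Subgroup G, IsMinimalNormal N := by
  obtain ⟨N, ⟨hN, hb⟩, hmin⟩ := Set.exists_min_image
    {N : Subgroup G | N.Normal ∧ N ≠ ⊥} (fun N => Nat.card N) (Set.toFinite _)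
    ⟨⊤, inferInstance, top_ne_bot⟩
  exact ⟨N, hN, hb, fun K hK hKN hKb => eq_of_le_of_card_ge hKN (hmin K ⟨hK, hKb⟩)⟩

namespace IsMinimalNormal

variable {N : Subgroup G}

theorem normalClosure_eq (hN : IsMinimalNormal N) {x : G} (hx : x ∈ N) (hx1 : x ≠ 1) :
    normalClosure {x} = N := by
  have := hN.normal
  refine hN.eq_of_le _ normalClosure_normal
    (normalClosure_le_normal (Set.singleton_subset_iff.mpr hx)) fun h => hx1 ?_
  rw [← mem_bot, ← h]
  exact subset_normalClosure rfl

theorem le_of_mem (hN : IsMinimalNormal N) {K : Subgroup G} [K.Normal] {x : G} (hx : x ∈ N)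
    (hx1 : x ≠ 1) (hxK : x ∈ K) : N ≤ K := by
  rw [← hN.normalClosure_eq hx hx1]
  exact normalClosure_le_normal (Set.singleton_subset_iff.mpr hxK)

theorem exists_conj (hN : IsMinimalNormal N) (hG : MagnusProperty G) {x y : G} (hx : x ∈ N)
    (hx1 : x ≠ 1) (hy : y ∈ N) (hy1 : y ≠ 1) : ∃ g, g * x * g⁻¹ = y ∨ g * x * g⁻¹ = y⁻¹ :=
  hG.exists_conj ((hN.normalClosure_eq hx hx1).trans (hN.normalClosure_eq hy hy1).symm)

theorem mul_comm_of_mem [Finite G] (hN : IsMinimalNormal N) (hG : MagnusProperty G) {a b : G}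
    (ha : a ∈ N) (hb : b ∈ N) : a * b = b * a := by
  have := hN.normal
  have : Nontrivial N := (nontrivial_iff_ne_bot N).mpr hN.ne_bot
  obtain ⟨r, hr, hrN⟩ := Nat.exists_prime_and_dvd (Finite.one_lt_card (α := N)).ne'
  have : Fact r.Prime := ⟨hr⟩
  obtain ⟨x, hx⟩ := exists_prime_orderOf_dvd_card' r hrN
  have hx1 : (x : G) ≠ 1 := by
    intro h
    have : x = 1 := Subtype.ext h
    rw [this, orderOf_one] at hx
    exact hr.one_lt.ne hx
  have hxr : (x : G) ^ r = 1 := by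
    have := pow_orderOf_eq_one x
    rw [hx] at this
    exact congrArg Subtype.val this
  have hp : IsPGroup r N := by
    intro y
    refine ⟨1, Subtype.ext ?_⟩
    rw [pow_one, coe_pow, coe_one]
    by_cases hy1 : (y : G) = 1
    · rw [hy1, one_pow]
    · obtain ⟨g, hg | hg⟩ := hN.exists_conj hG x.2 hx1 y.2 hy1
      · rw [← hg, conj_pow, hxr, mul_one, mul_inv_cancel]
      · rw [← inv_inv (y : G), ← hg, inv_pow, conj_pow, hxr, mul_one, mul_inv_cancel, inv_one]
  have hc : (center N).map N.subtype = N := by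
    refine hN.eq_of_le _ inferInstance (map_subtype_le _) fun h => ?_
    rw [map_eq_bot_iff_of_injective _ N.subtype_injective] at h
    exact (nontrivial_iff_ne_bot _).mp hp.center_nontrivial h
  rw [← hc] at ha
  obtain ⟨a', ha', rfl⟩ := ha
  exact congrArg Subtype.val (mem_center_iff.mp ha' ⟨b, hb⟩).symm

end IsMinimalNormal

/-- The conjugation action of a subgroup on a commutative normal subgroup. -/
def conjAddAction (M N : Subgroup G) [N.Normal] [IsMulCommutative N] :
    M →* AddMonoid.End (Additive N) where
  toFun m := MonoidHom.toAdditive (MulAut.conjNormal (m : G) : MulAut N).toMonoidHom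
  map_one' := by
    rw [coe_one, map_one]
    rfl
  map_mul' _ _ := by
    rw [coe_mul, map_mul]
    rfl

theorem coe_conjAddAction (M N : Subgroup G) [N.Normal] [IsMulCommutative N] (m : M)
    (v : Additive N) : ((conjAddAction M N m v).toMul : G) = m * v.toMul * (m : G)⁻¹ :=
  MulAut.conjNormal_apply _ _

section Complement

variable {M N : Subgroup G}

theorem IsMinimalNormal.isComplement [Finite G] (hN : IsMinimalNormal N) (hG : MagnusProperty G)
    (hM : IsCoatom M) (hcore : M.normalCore = ⊥) : IsComplement' M N := by
  have := hN.normal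
  have hsup : M ⊔ N = ⊤ := by
    refine hM.2 _ (left_lt_sup.mpr fun hle => hN.ne_bot ?_)
    rw [eq_bot_iff, ← hcore]
    exact normal_le_normalCore.mpr hle
  refine isComplement'_of_disjoint_and_mul_eq_univ (disjoint_iff.mpr ?_) ?_
  · have hnorm : (M ⊓ N).Normal := by
      refine ⟨fun x hx g => ?_⟩
      have hg : g ∈ ((M ⊔ N : Subgroup G) : Set G) := by rw [hsup]; trivial
      rw [mul_normal] at hg
      obtain ⟨m, hm, n, hn, rfl⟩ := hg
      have h1 : n * x * n⁻¹ = x := by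
        rw [hN.mul_comm_of_mem hG hn hx.2, mul_inv_cancel_right]
      have h2 : m * n * x * (m * n)⁻¹ = m * x * m⁻¹ := by
        nth_rw 2 [← h1]
        group
      simp only [h2]
      exact ⟨M.mul_mem (M.mul_mem hm hx.1) (M.inv_mem hm), this.conj_mem x hx.2 m⟩
    rw [eq_bot_iff, ← hcore]
    exact normal_le_normalCore.mpr inf_le_left
  · rw [← mul_normal, hsup]
    rfl

theorem IsMinimalNormal.exists_commutator_ne_one (hN : IsMinimalNormal N)
    (hc : IsComplement' M N) (hcore : M.normalCore = ⊥) {x : G} (hx : x ∈ M) (hx1 : x ≠ 1) :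
    ∃ w ∈ N, x * w * x⁻¹ * w⁻¹ ≠ 1 := by
  have := hN.normal
  by_contra! h
  have hxc : x ∈ M ⊓ centralizer (N : Set G) :=
    ⟨hx, mem_centralizer_iff.mpr fun w hw => by
      have := h w hw
      rw [mul_inv_eq_one, mul_inv_eq_iff_eq_mul] at this
      exact this.symm⟩
  have hnorm : (M ⊓ centralizer (N : Set G)).Normal := by
    refine ⟨fun y hy g => ?_⟩
    obtain ⟨⟨m, n⟩, rfl⟩ := hc.2 g
    have h1 : (n : G) * y * (n : G)⁻¹ = y := by
      rw [mem_centralizer_iff.mp hy.2 n n.2, mul_inv_cancel_right]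
    have h2 : (m : G) * n * y * ((m : G) * n)⁻¹ = m * y * (m : G)⁻¹ := by
      nth_rw 2 [← h1]
      group
    simp only [h2]
    exact ⟨M.mul_mem (M.mul_mem m.2 hy.1) (M.inv_mem m.2),
      (inferInstance : (centralizer (N : Set G)).Normal).conj_mem y hy.2 m⟩
  have := normal_le_normalCore.mpr (inf_le_left : M ⊓ centralizer (N : Set G) ≤ M) hxc
  rw [hcore] at this
  exact hx1 (mem_bot.mp this)

theorem IsMinimalNormal.normalClosure_mul_eq [Finite G] (hN : IsMinimalNormal N)
    (hG : MagnusProperty G)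
    {x v w : G} (hv : v ∈ N) (hw : w ∈ N) (hxw : x * w * x⁻¹ * w⁻¹ ≠ 1) :
    normalClosure {x} = normalClosure {x * v} := by
  have := hN.normal
  have key : ∀ y, y * w * y⁻¹ * w⁻¹ = x * w * x⁻¹ * w⁻¹ → N ≤ normalClosure {y} := by
    intro y hy
    have hn : x * w * x⁻¹ * w⁻¹ ∈ N :=
      N.mul_mem (this.conj_mem w hw x) (N.inv_mem hw)
    refine hN.le_of_mem hn hxw ?_
    rw [← hy]
    have hyy : y ∈ normalClosure {y} := subset_normalClosure rfl
    have := mul_mem hyy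
      ((normalClosure_normal (s := {y})).conj_mem _ (inv_mem hyy) w)
    rwa [← mul_assoc, ← mul_assoc] at this
  have hx : N ≤ normalClosure {x} := key x rfl
  have hxv : N ≤ normalClosure {x * v} := by
    refine key _ ?_
    have h1 : v * w * v⁻¹ = w := by rw [hN.mul_comm_of_mem hG hv hw, mul_inv_cancel_right]
    nth_rw 3 [← h1]
    group
  refine le_antisymm (normalClosure_le_normal (Set.singleton_subset_iff.mpr ?_))
    (normalClosure_le_normal (Set.singleton_subset_iff.mpr ?_))
  · have := mul_mem (subset_normalClosure rfl : x * v ∈ normalClosure {x * v})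
      (inv_mem (hxv hv))
    rwa [mul_inv_cancel_right] at this
  · exact mul_mem (subset_normalClosure rfl) (hx hv)

theorem IsMinimalNormal.exists_eq_commutator [Finite G] (hN : IsMinimalNormal N)
    (hG : MagnusProperty G)
    (hc : IsComplement' M N) (hcore : M.normalCore = ⊥) {x v : G} (hx : x ∈ M) (hx1 : x ≠ 1)
    (hv : v ∈ N) : ∃ w ∈ N, x⁻¹ * w * x * w⁻¹ = v := by
  have := hN.normal
  obtain ⟨w₀, hw₀, hne⟩ := hN.exists_commutator_ne_one hc hcore hx hx1
  have hcl := hN.normalClosure_mul_eq hG hv hw₀ hne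
  have hxv : ∃ y ∈ M, ∃ w ∈ N, w * y * w⁻¹ = x * v := by
    obtain ⟨g, hg⟩ := hG.exists_conj hcl.symm
    obtain ⟨⟨m, n⟩, hmn⟩ := hc.2 g
    have hmn : (m : G) * n = g := hmn
    subst hmn
    refine hg.elim (fun h => ⟨(m : G)⁻¹ * x * m, ?_, (n : G)⁻¹, N.inv_mem n.2, ?_⟩)
      (fun h => ⟨(m : G)⁻¹ * x⁻¹ * m, ?_, (n : G)⁻¹, N.inv_mem n.2, ?_⟩)
    · exact M.mul_mem (M.mul_mem (M.inv_mem m.2) hx) m.2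
    · rw [← inv_mul_cancel_left ((m : G) * n) (x * v), mul_inv_eq_iff_eq_mul.mp h]
      group
    · exact M.mul_mem (M.mul_mem (M.inv_mem m.2) (M.inv_mem hx)) m.2
    · rw [← inv_mul_cancel_left ((m : G) * n) (x * v), mul_inv_eq_iff_eq_mul.mp h]
      group
  obtain ⟨y, hy, w, hw, h⟩ := hxv
  have h1 : x⁻¹ * y ∈ M ⊓ N := by
    refine ⟨M.mul_mem (M.inv_mem hx) hy, ?_⟩
    have h2 : x⁻¹ * y = v * (w * (y⁻¹ * w⁻¹ * y)) := by
      rw [eq_comm, ← mul_right_inj x, ← mul_assoc x v, ← h]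
      group
    rw [h2]
    refine N.mul_mem hv (N.mul_mem hw ?_)
    simpa using this.conj_mem _ (N.inv_mem hw) y⁻¹
  rw [hc.disjoint.eq_bot, mem_bot, inv_mul_eq_one] at h1
  subst h1
  exact ⟨w, hw, by rw [mul_assoc, mul_assoc, ← mul_assoc w, h, inv_mul_cancel_left]⟩

theorem IsMinimalNormal.isSemiregularAction [Finite G] (hN : IsMinimalNormal N)
    (hG : MagnusProperty G)
    (hc : IsComplement' M N) (hcore : M.normalCore = ⊥) [N.Normal] [IsMulCommutative N] :
    IsSemiregularAction (H := M) (V := Additive N) (conjAddAction M N) := by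
  intro h v hv
  by_contra! hcon
  obtain ⟨hh, hv0⟩ := hcon
  have hinv : conjAddAction M N h⁻¹ v = v := by
    nth_rw 1 [← hv]
    change (conjAddAction M N h⁻¹ * conjAddAction M N h) v = v
    rw [← map_mul, inv_mul_cancel, map_one]
    rfl
  let φ : Additive N → Additive N := fun w => conjAddAction M N h⁻¹ w - w
  have hsurj : Function.Surjective φ := by
    intro u
    obtain ⟨w, hw, hwu⟩ := hN.exists_eq_commutator hG hc hcore h.2
      (fun h1 => hh (Subtype.ext h1)) u.toMul.2
    refine ⟨Additive.ofMul ⟨w, hw⟩, ?_⟩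
    apply Additive.toMul.injective
    refine Subtype.ext ?_
    rw [← hwu]
    change ((conjAddAction M N h⁻¹ (Additive.ofMul ⟨w, hw⟩)).toMul : G) / w = _
    rw [coe_conjAddAction]
    simp [div_eq_mul_inv]
  refine hv0 (Finite.injective_iff_surjective.mpr hsurj ?_)
  simp [φ, hinv]

theorem IsMinimalNormal.exists_conjAddAction_eq [Finite G] (hN : IsMinimalNormal N)
    (hG : MagnusProperty G)
    (hc : IsComplement' M N) [N.Normal] [IsMulCommutative N] {v w : Additive N} (hv : v ≠ 0)
    (hw : w ≠ 0) : ∃ h : M, conjAddAction M N h v = w ∨ conjAddAction M N h v = -w := by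
  obtain ⟨g, hg⟩ := hN.exists_conj hG v.toMul.2 (fun h => hv (Subtype.ext h)) w.toMul.2
    (fun h => hw (Subtype.ext h))
  obtain ⟨⟨m, n⟩, rfl⟩ := hc.2 g
  have h1 : (m : G) * n * v.toMul * ((m : G) * n)⁻¹ = m * v.toMul * (m : G)⁻¹ := by
    rw [mul_assoc (m : G), hN.mul_comm_of_mem hG n.2 v.toMul.2]
    group
  simp only [h1] at hg
  rw [← coe_conjAddAction] at hg
  exact ⟨m, hg.imp (fun h => Subtype.ext h) (fun h => Subtype.ext h)⟩

end Complement

theorem MagnusProperty.index_mem_of_normalCore_eq_bot [Finite G] (hG : MagnusProperty G)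
    {M : Subgroup G} (hM : IsCoatom M) (hcore : M.normalCore = ⊥) :
    M.index ∈ ({2, 3, 4, 5, 7, 9} : Set ℕ) := by
  have : Nontrivial G := by
    by_contra h
    rw [not_nontrivial_iff_subsingleton] at h
    exact hM.1 (Subsingleton.elim _ _)
  obtain ⟨N, hN⟩ := exists_isMinimalNormal G
  have := hN.normal
  have : IsMulCommutative N := ⟨⟨fun a b => Subtype.ext (hN.mul_comm_of_mem hG a.2 b.2)⟩⟩
  have : Nontrivial N := (nontrivial_iff_ne_bot N).mpr hN.ne_bot
  have hc := hN.isComplement hG hM hcore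
  have hMP : MagnusProperty M :=
    hG.of_surjective (hc.QuotientMulEquiv.toMonoidHom.comp (QuotientGroup.mk' N))
      (hc.QuotientMulEquiv.surjective.comp (QuotientGroup.mk'_surjective N))
  have hρ := hN.isSemiregularAction hG hc hcore
  have := hρ.card_mem hMP (hρ.card_eq_of_transitive fun v w hv hw =>
    hN.exists_conjAddAction_eq hG hc hv hw)
  rwa [hc.symm.index_eq_card]

end Reduction

theorem MP_maximal_subgroup_index (G : Type*) [Group G] [Finite G] (hG : MagnusProperty G)
    (M : Subgroup G) (hM : IsCoatom M) :
    M.index ∈ ({2, 3, 4, 5, 7, 9} : Set ℕ) := by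
  have hker : (QuotientGroup.mk' M.normalCore).ker ≤ M := by
    rw [QuotientGroup.ker_mk']
    exact M.normalCore_le
  have hsurj := QuotientGroup.mk'_surjective M.normalCore
  have hcomap : (M.map (QuotientGroup.mk' M.normalCore)).comap (QuotientGroup.mk' M.normalCore)
      = M := Subgroup.comap_map_eq_self hker
  rw [← Subgroup.index_map_eq M hsurj hker]
  refine (hG.of_surjective _ hsurj).index_mem_of_normalCore_eq_bot ⟨fun h => hM.1 ?_, ?_⟩ ?_
  · rw [← hcomap, h, Subgroup.comap_top]
  · intro K hK
    have h1 : K.comap (QuotientGroup.mk' M.normalCore) = ⊤ := by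
      refine hM.2 _ ?_
      exact hcomap.symm.trans_lt ((Subgroup.comap_lt_comap_of_surjective hsurj).mpr hK)
    rw [← Subgroup.map_comap_eq_self_of_surjective hsurj K, h1,
      Subgroup.map_top_of_surjective _ hsurj]
  · have h1 : (M.map (QuotientGroup.mk' M.normalCore)).normalCore.comap
        (QuotientGroup.mk' M.normalCore) ≤ M.normalCore := by
      refine Subgroup.normal_le_normalCore.mpr ?_
      exact (Subgroup.comap_mono (Subgroup.normalCore_le _)).trans hcomap.le
    rw [eq_bot_iff, ← Subgroup.map_comap_eq_self_of_surjective hsurj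
      (M.map (QuotientGroup.mk' M.normalCore)).normalCore]
    refine (Subgroup.map_mono h1).trans ?_
    rw [QuotientGroup.map_mk'_self]
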